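/- arXiv:1608.04884 — 14 statements merged into one kernel-verified Lean document; each statement's English description precedes it below -/
import Mathlib

section
/- Let c, b, θ, φ be real numbers with c > b > 0 and θ ≥ 0. Then every complex number λ satisfying the quasipolynomial equation λ² + cλ + 1 = b·e^{iφ}·λ·e^{−λθ} has Re λ < 0. -/
open Complex

/-- If `c > b > 0` and `θ ≥ 0`, every complex root `z` of the quasipolynomial
equation `z² + c z + 1 = b e^{iφ} z e^{−zθ}` has negative real part. -/
theorem quasipolynomial_stable_offcritical
    (c b θ φ : ℝ) (hcb : c > b) (hb : b > 0) (hθ : θ ≥ 0) (z : ℂ)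
    (hz : z ^ 2 + (c : ℂ) * z + 1 =
      (b : ℂ) * Complex.exp (Complex.I * (φ : ℂ)) * z * Complex.exp (-z * (θ : ℂ))) :
    z.re < 0 := by
  by_contra hneg
  have hre : 0 ≤ z.re := not_lt.mp hneg
  have hz0 : z ≠ 0 := by
    rintro rfl
    simp at hz
  have h1 : z + (c : ℂ) + z⁻¹ =
      (b : ℂ) * Complex.exp (Complex.I * (φ : ℂ)) * Complex.exp (-z * (θ : ℂ)) := by
    apply mul_right_cancel₀ hz0
    have h2 : (z + (c : ℂ) + z⁻¹) * z = z ^ 2 + (c : ℂ) * z + 1 := by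
      rw [add_mul, inv_mul_cancel₀ hz0]
      ring
    rw [h2, hz]
    ring
  have hnorm : ‖(b : ℂ) * Complex.exp (Complex.I * (φ : ℂ)) *
      Complex.exp (-z * (θ : ℂ))‖ ≤ b := by
    have h3 : Real.exp (-(z.re * θ)) ≤ 1 := by
      rw [Real.exp_le_one_iff]
      have := mul_nonneg hre hθ
      linarith
    rw [norm_mul, norm_mul, Complex.norm_exp, Complex.norm_exp, Complex.norm_real,
      Real.norm_of_nonneg hb.le]
    simp
    nlinarith
  have hle := (Complex.re_le_norm (z + (c : ℂ) + z⁻¹)).trans (h1 ▸ hnorm)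
  have hinv : 0 ≤ (z⁻¹).re := by
    rw [Complex.inv_re]
    exact div_nonneg hre (Complex.normSq_nonneg z)
  simp only [Complex.add_re, Complex.ofReal_re] at hle
  linarith
end

section
/- Let b > 0 be real. Then every complex number λ satisfying λ² + bλ + 1 = −b·λ·e^{−λπ/3} has Re λ < 0. (In particular this equation has no purely imaginary roots.) -/
open Complex Real

/-- For any control strength `b > 0`, every complex root `z` of
`z² + b z + 1 = −b z e^{−zπ/3}` has negative real part (in particular the
equation has no purely imaginary roots). -/
theorem quasipolynomial_stable_Z3t
    (b : ℝ) (hb : 0 < b) (z : ℂ)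
    (hz : z ^ 2 + (b : ℂ) * z + 1 =
      -(b : ℂ) * z * Complex.exp (-z * ((π : ℝ) / 3 : ℝ))) :
    z.re < 0 := by
  by_contra hx
  push Not at hx
  set E := Complex.exp (-z * ((π : ℝ) / 3 : ℝ)) with hE
  have hEr : E.re = Real.exp (-z.re * (π / 3)) * Real.cos (z.im * (π / 3)) := by
    rw [hE, Complex.exp_re, Complex.re_mul_ofReal, Complex.im_mul_ofReal, Complex.neg_re,
      Complex.neg_im, neg_mul z.im, Real.cos_neg]
  have hEi : E.im = -(Real.exp (-z.re * (π / 3)) * Real.sin (z.im * (π / 3))) := by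
    rw [hE, Complex.exp_im, Complex.re_mul_ofReal, Complex.im_mul_ofReal, Complex.neg_re,
      Complex.neg_im, neg_mul z.im, Real.sin_neg, mul_neg]
  clear_value E
  have hre := congrArg Complex.re hz
  have him := congrArg Complex.im hz
  simp [pow_two] at hre him
  generalize z.re = x at *
  generalize z.im = y at *
  have hpi := Real.pi_pos
  have hle : Real.exp (-x * (π / 3)) ≤ 1 := by
    rw [Real.exp_le_one_iff]
    have : 0 ≤ x * (π / 3) := by positivity
    linarith
  have hpos := Real.exp_pos (-x * (π / 3))
  have hc := Real.neg_one_le_cos (y * (π / 3))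
  have hEr1 : -1 ≤ E.re := by rw [hEr]; nlinarith
  have h1 : x * (x ^ 2 + y ^ 2) + x + b * (x ^ 2 + y ^ 2) * (1 + E.re) = 0 := by
    linear_combination x * hre + y * him
  have h2 : y * (x ^ 2 + y ^ 2) - y + b * (x ^ 2 + y ^ 2) * E.im = 0 := by
    linear_combination x * him - y * hre
  have h3 : 0 ≤ b * (x ^ 2 + y ^ 2) * (1 + E.re) :=
    mul_nonneg (by positivity) (by linarith)
  have h4 : 0 ≤ x * (x ^ 2 + y ^ 2) := by positivity
  have hx0 : x = 0 := by linarith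
  subst hx0
  have hy : y ≠ 0 := by
    rintro rfl
    simp at hre
  have hEr2 : E.re = -1 := by
    have h5 : b * (0 ^ 2 + y ^ 2) ≠ 0 := by
      have : 0 < y ^ 2 := by positivity
      have := mul_pos hb this
      simp only [ne_eq, OfNat.ofNat_ne_zero, not_false_eq_true, zero_pow, zero_add]
      exact this.ne'
    have h6 : b * (0 ^ 2 + y ^ 2) * (1 + E.re) = 0 := by linarith
    have := (mul_eq_zero.mp h6).resolve_left h5
    linarith
  simp only [neg_zero, zero_mul, Real.exp_zero, one_mul] at hEr hEi
  have hcos : Real.cos (y * (π / 3)) = -1 := by linarith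
  have hsin : Real.sin (y * (π / 3)) = 0 := by
    have := Real.sin_sq_add_cos_sq (y * (π / 3))
    rw [hcos] at this
    have h7 : Real.sin (y * (π / 3)) ^ 2 = 0 := by linarith
    exact pow_eq_zero_iff (two_ne_zero) |>.mp h7
  rw [hEi, hsin] at h2
  have h8 : y * ((y - 1) * (y + 1)) = 0 := by linear_combination h2
  rcases mul_eq_zero.mp ((mul_eq_zero.mp h8).resolve_left hy) with h | h
  · have : y = 1 := by linarith
    rw [this, one_mul, Real.cos_pi_div_three] at hcos
    norm_num at hcos
  · have : y = -1 := by linarith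
    rw [this, neg_one_mul, Real.cos_neg, Real.cos_pi_div_three] at hcos
    norm_num at hcos
end

section
/- For every real b, λ = i is a root of the equation λ² + bλ + 1 = b·e^{iπ/3}·λ·e^{−λπ/3}. Moreover, if b > 0, then λ = i is the ONLY complex root of this equation with Re λ ≥ 0. -/
open Complex Real

/-- For every real `b`, `λ = i` is a root of
`λ² + bλ + 1 = b e^{iπ/3} λ e^{−λπ/3}`; moreover, for `b > 0` it is the only
root with nonnegative real part. -/
theorem critical_root_plusZ3t (b : ℝ) :
    (Complex.I ^ 2 + (b : ℂ) * Complex.I + 1 =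
      (b : ℂ) * Complex.exp (Complex.I * ((π : ℝ) / 3 : ℝ)) * Complex.I *
        Complex.exp (-Complex.I * ((π : ℝ) / 3 : ℝ))) ∧
    (0 < b → ∀ z : ℂ,
      z ^ 2 + (b : ℂ) * z + 1 =
        (b : ℂ) * Complex.exp (Complex.I * ((π : ℝ) / 3 : ℝ)) * z *
          Complex.exp (-z * ((π : ℝ) / 3 : ℝ)) →
      0 ≤ z.re → z = Complex.I) := by
  constructor
  · have h : Complex.exp (Complex.I * ((π : ℝ) / 3 : ℝ)) *
        Complex.exp (-Complex.I * ((π : ℝ) / 3 : ℝ)) = 1 := by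
      rw [← Complex.exp_add]
      simp
    linear_combination Complex.I_sq - (b : ℂ) * Complex.I * h
  · intro hb z hz hx
    have hE : Complex.exp (Complex.I * ((π : ℝ) / 3 : ℝ)) *
        Complex.exp (-z * ((π : ℝ) / 3 : ℝ)) =
        Complex.exp (((-z.re * (π / 3) : ℝ) : ℂ) +
          (((1 - z.im) * (π / 3) : ℝ) : ℂ) * Complex.I) := by
      rw [← Complex.exp_add]
      congr 1
      apply Complex.ext <;> simp
      ring
    have hz2 : z ^ 2 + (b : ℂ) * z + 1 = (b : ℂ) * (z * Complex.exp
        (((-z.re * (π / 3) : ℝ) : ℂ) + (((1 - z.im) * (π / 3) : ℝ) : ℂ) * Complex.I)) := by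
      rw [hz, ← hE]
      ring
    obtain ⟨x, y⟩ := z
    simp only at hx hz2
    have hre := congrArg Complex.re hz2
    have him := congrArg Complex.im hz2
    rw [Complex.re_ofReal_mul, Complex.mul_re, Complex.exp_re, Complex.exp_im] at hre
    rw [Complex.im_ofReal_mul, Complex.mul_im, Complex.exp_re, Complex.exp_im] at him
    have e1 : (((-x * (π / 3) : ℝ) : ℂ) + (((1 - y) * (π / 3) : ℝ) : ℂ) * Complex.I).re
        = -x * (π / 3) := by
      rw [Complex.add_re, Complex.re_ofReal_mul, Complex.ofReal_re, Complex.I_re]; ring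
    have e2 : (((-x * (π / 3) : ℝ) : ℂ) + (((1 - y) * (π / 3) : ℝ) : ℂ) * Complex.I).im
        = (1 - y) * (π / 3) := by
      rw [Complex.add_im, Complex.im_ofReal_mul, Complex.ofReal_im, Complex.I_im]; ring
    rw [e1, e2] at hre him
    simp only [pow_two, Complex.add_re, Complex.add_im, Complex.mul_re, Complex.mul_im,
      Complex.ofReal_re, Complex.ofReal_im, Complex.one_re, Complex.one_im] at hre him
    have hr1 : Real.exp (-x * (π / 3)) ≤ 1 := by
      rw [Real.exp_le_one_iff]
      nlinarith [Real.pi_pos]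
    have hr0 := Real.exp_pos (-x * (π / 3))
    have hc := Real.cos_le_one ((1 - y) * (π / 3))
    have hcs := Real.sin_sq_add_cos_sq ((1 - y) * (π / 3))
    have hrc : Real.exp (-x * (π / 3)) * Real.cos ((1 - y) * (π / 3)) ≤ 1 := by
      nlinarith
    have key : x * (x ^ 2 + y ^ 2 + 1) = b * (x ^ 2 + y ^ 2) *
        (Real.exp (-x * (π / 3)) * Real.cos ((1 - y) * (π / 3)) - 1) := by
      linear_combination x * hre + y * him
    have hx0 : x = 0 := by
      have h1 : x * (x ^ 2 + y ^ 2 + 1) ≤ 0 := by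
        rw [key]
        exact mul_nonpos_of_nonneg_of_nonpos (by positivity) (by linarith)
      have : 0 ≤ x * (x ^ 2 + y ^ 2) := by positivity
      nlinarith
    subst hx0
    simp only [neg_zero, zero_mul, Real.exp_zero] at hre him key
    have hy : y ≠ 0 := by
      rintro rfl
      norm_num at hre
    have hc1 : Real.cos ((1 - y) * (π / 3)) = 1 := by
      have h2 : b * y ^ 2 * (Real.cos ((1 - y) * (π / 3)) - 1) = 0 := by
        linear_combination -key
      have h3 : b * y ^ 2 ≠ 0 := by positivity
      have := (mul_eq_zero.mp h2).resolve_left h3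
      linarith
    have hs0 : Real.sin ((1 - y) * (π / 3)) = 0 := by
      rw [hc1] at hcs
      have : Real.sin ((1 - y) * (π / 3)) ^ 2 = 0 := by linarith
      exact pow_eq_zero_iff (two_ne_zero) |>.mp this
    rw [hs0] at hre
    have hyy : (y - 1) * (y + 1) = 0 := by linarith
    rcases mul_eq_zero.mp hyy with h | h
    · have : y = 1 := by linarith
      subst this
      rfl
    · have : y = -1 := by linarith
      subst this
      have e : (1 - (-1 : ℝ)) * (π / 3) = π - π / 3 := by ring
      rw [e, Real.cos_pi_sub, Real.cos_pi_div_three] at hc1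
      norm_num at hc1
end

section
/- For every real b, λ = i is a root of the equation λ² + bλ + 1 = i·b·λ·e^{−λπ/2}. Moreover, if b > 0, then λ = i is the ONLY complex root of this equation with Re λ ≥ 0. -/
open Complex Real

/-- For every real `b`, `λ = i` is a root of
`λ² + bλ + 1 = i b λ e^{−λπ/2}`; moreover, for `b > 0` it is the only root
with nonnegative real part. -/
theorem critical_root_Z4c (b : ℝ) :
    (Complex.I ^ 2 + (b : ℂ) * Complex.I + 1 =
      Complex.I * (b : ℂ) * Complex.I * Complex.exp (-Complex.I * ((π : ℝ) / 2 : ℝ))) ∧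
    (0 < b → ∀ z : ℂ,
      z ^ 2 + (b : ℂ) * z + 1 =
        Complex.I * (b : ℂ) * z * Complex.exp (-z * ((π : ℝ) / 2 : ℝ)) →
      0 ≤ z.re → z = Complex.I) := by
  have hE : Complex.exp (-Complex.I * ((π : ℝ) / 2 : ℝ)) = -Complex.I := by
    have h : -Complex.I * ((π : ℝ) / 2 : ℝ) = -(π / 2 * Complex.I) := by push_cast; ring
    rw [h, Complex.exp_neg, Complex.exp_pi_div_two_mul_I, Complex.inv_I]
  have hE' : Complex.exp (-(-Complex.I) * ((π : ℝ) / 2 : ℝ)) = Complex.I := by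
    have h : -(-Complex.I) * ((π : ℝ) / 2 : ℝ) = (π / 2 * Complex.I) := by push_cast; ring
    rw [h, Complex.exp_pi_div_two_mul_I]
  refine ⟨?_, ?_⟩
  · rw [hE]
    linear_combination (1 + b * Complex.I) * Complex.I_sq
  intro hb z hz hre
  have hexp : ‖Complex.exp (-z * ((π : ℝ) / 2 : ℝ))‖ ≤ 1 := by
    rw [Complex.norm_exp, Complex.re_mul_ofReal, Complex.neg_re]
    apply Real.exp_le_one_iff.mpr
    have := mul_nonneg hre (by positivity : (0 : ℝ) ≤ π / 2)
    linarith
  have hn : ‖z ^ 2 + (b : ℂ) * z + 1‖ ≤ ‖(b : ℂ) * z‖ := by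
    rw [hz, norm_mul, mul_assoc, norm_mul, Complex.norm_I, one_mul]
    exact mul_le_of_le_one_right (norm_nonneg _) hexp
  have hsq : Complex.normSq (z ^ 2 + (b : ℂ) * z + 1) ≤ Complex.normSq ((b : ℂ) * z) := by
    rw [Complex.normSq_eq_norm_sq, Complex.normSq_eq_norm_sq]
    gcongr
  have key : Complex.normSq (z ^ 2 + (b : ℂ) * z + 1) =
      Complex.normSq (z ^ 2 + 1) + Complex.normSq ((b : ℂ) * z)
        + 2 * (b * z.re * (z.re ^ 2 + z.im ^ 2 + 1)) := by
    simp [Complex.normSq_apply, pow_two]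
    ring
  have h0 : 0 ≤ b * z.re * (z.re ^ 2 + z.im ^ 2 + 1) := by positivity
  have h1 := Complex.normSq_nonneg (z ^ 2 + 1)
  have h2 : z ^ 2 + 1 = 0 := Complex.normSq_eq_zero.mp (by linarith)
  have h3 : (z - Complex.I) * (z + Complex.I) = 0 := by
    linear_combination h2 - Complex.I_sq
  rcases mul_eq_zero.mp h3 with h | h
  · exact sub_eq_zero.mp h
  · exfalso
    have h4 : z = -Complex.I := eq_neg_of_add_eq_zero_left h
    rw [h4, hE'] at hz
    have h5 := congrArg Complex.im hz
    simp [pow_two] at h5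
    linarith
end

section
/- Let a, b, s be real numbers with 1 < s < 3 and suppose λ = i·s is a root of λ² + (b − 2a)λ + 1 = −b·λ·e^{−λπ/3}. Then sin(sπ/3) ≠ 0 and necessarily b = (s² − 1)/(s·sin(sπ/3)) and a = (s² − 1)(1 + cos(sπ/3))/(2s·sin(sπ/3)). -/
open Complex Real

/-- If `1 < s < 3` and `λ = is` is a root of
`λ² + (b − 2a)λ + 1 = −bλ e^{−λπ/3}`, then `sin(sπ/3) ≠ 0` and necessarily
`b = (s² − 1)/(s sin(sπ/3))` and `a = (s² − 1)(1 + cos(sπ/3))/(2s sin(sπ/3))`. -/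
theorem pure_imaginary_root_on_curve (a b s : ℝ) (hs1 : 1 < s) (hs3 : s < 3)
    (hroot : (Complex.I * (s : ℂ)) ^ 2 + ((b - 2 * a : ℝ) : ℂ) * (Complex.I * (s : ℂ)) + 1 =
      -(b : ℂ) * (Complex.I * (s : ℂ)) *
        Complex.exp (-(Complex.I * (s : ℂ)) * ((π : ℝ) / 3 : ℝ))) :
    Real.sin (s * π / 3) ≠ 0 ∧
    b = (s ^ 2 - 1) / (s * Real.sin (s * π / 3)) ∧
    a = (s ^ 2 - 1) * (1 + Real.cos (s * π / 3)) / (2 * s * Real.sin (s * π / 3)) := by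
  have hspos : 0 < s := by linarith
  have hsin : 0 < Real.sin (s * π / 3) := by
    apply Real.sin_pos_of_pos_of_lt_pi
    · have := Real.pi_pos
      positivity
    · nlinarith [Real.pi_pos]
  have hexp : Complex.exp (-(Complex.I * (s : ℂ)) * ((π : ℝ) / 3 : ℝ)) =
      (Real.cos (s * π / 3) : ℂ) - (Real.sin (s * π / 3) : ℂ) * Complex.I := by
    have h : -(Complex.I * (s : ℂ)) * ((π : ℝ) / 3 : ℝ) =
        ((-(s * π / 3) : ℝ) : ℂ) * Complex.I := by
      push_cast
      ring
    rw [h, Complex.exp_mul_I, ← Complex.ofReal_cos, ← Complex.ofReal_sin, Real.cos_neg,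
      Real.sin_neg]
    push_cast
    ring
  rw [hexp] at hroot
  generalize Real.sin (s * π / 3) = S at *
  generalize Real.cos (s * π / 3) = C at *
  have hre := congrArg Complex.re hroot
  have him := congrArg Complex.im hroot
  simp [pow_two] at hre him
  have hb : b * (s * S) = s ^ 2 - 1 := by linarith
  have ha : 2 * a = b * (1 + C) := by
    apply mul_left_cancel₀ hspos.ne'
    linarith
  refine ⟨hsin.ne', ?_, ?_⟩
  · rw [eq_div_iff (by positivity)]
    exact hb
  · rw [eq_div_iff (by positivity), ← hb]
    linear_combination s * S * ha
end

section
/- The function γ₂(s) = (s² − 1)/(s·sin(sπ/3)) is strictly increasing on the interval [1, 3), satisfies γ₂(1) = 0, and tends to +∞ as s → 3⁻. -/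
open Real Filter

/-- Second coordinate of the curve bounding the stability domain. -/
noncomputable def gamma2 (s : ℝ) : ℝ :=
  (s ^ 2 - 1) / (s * Real.sin (s * π / 3))

theorem gamma2_aux_sin_pos {s : ℝ} (h1 : 0 < s) (h3 : s < 3) : 0 < Real.sin (s * π / 3) := by
  have := Real.pi_pos
  apply Real.sin_pos_of_pos_of_lt_pi
  · positivity
  · nlinarith

theorem gamma2_aux_sinc {x y : ℝ} (h1 : 0 < x) (hxy : x < y) (h3 : y < 3) :
    x * Real.sin (y * π / 3) < y * Real.sin (x * π / 3) := by
  have hpi := Real.pi_pos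
  have h := strictConcaveOn_sin_Icc.slope_anti_adjacent (x := 0) (y := x * π / 3)
    (z := y * π / 3) ⟨le_rfl, hpi.le⟩ ⟨by nlinarith, by nlinarith⟩ (by positivity)
    (by nlinarith)
  rw [div_lt_div_iff₀ (by nlinarith) (by nlinarith [mul_pos h1 hpi])] at h
  simp only [Real.sin_zero, sub_zero] at h
  have h' : (π / 3) * (x * Real.sin (y * π / 3)) < (π / 3) * (y * Real.sin (x * π / 3)) := by
    linarith
  exact lt_of_mul_lt_mul_left h' (by positivity)

/-- `γ₂(s) = (s² − 1)/(s sin(sπ/3))` is strictly increasing on `[1,3)`,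
vanishes at `s = 1`, and tends to `+∞` as `s → 3⁻`. -/
theorem gamma2_strictMono_zero_tendsto :
    StrictMonoOn gamma2 (Set.Ico (1 : ℝ) 3) ∧
    gamma2 1 = 0 ∧
    Tendsto gamma2 (nhdsWithin 3 (Set.Iio 3)) atTop := by
  refine ⟨?_, by simp [gamma2], ?_⟩
  · rintro x ⟨hx1, hx3⟩ y ⟨hy1, hy3⟩ hxy
    have hx : 0 < x := by linarith
    have hy : 0 < y := by linarith
    have hs := gamma2_aux_sinc hx hxy hy3
    have ha := gamma2_aux_sin_pos hx hx3
    have hb := gamma2_aux_sin_pos hy hy3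
    unfold gamma2
    rw [div_lt_div_iff₀ (by positivity) (by positivity)]
    generalize Real.sin (x * π / 3) = A at *
    generalize Real.sin (y * π / 3) = B at *
    have hx2 : 0 ≤ x ^ 2 - 1 := by nlinarith
    have e1 : (x ^ 2 - 1) * y ^ 2 * (x * B) ≤ (x ^ 2 - 1) * y ^ 2 * (y * A) :=
      mul_le_mul_of_nonneg_left hs.le (by positivity)
    have e2 : (x ^ 2 - 1) * y ^ 2 * (y * A) < (y ^ 2 - 1) * x ^ 2 * (y * A) :=
      mul_lt_mul_of_pos_right (by nlinarith) (by positivity)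
    have e3 : (x * y) * ((x ^ 2 - 1) * (y * B)) < (x * y) * ((y ^ 2 - 1) * (x * A)) := by
      linarith
    exact lt_of_mul_lt_mul_left e3 (by positivity)
  · have hn : Tendsto (fun s : ℝ => s ^ 2 - 1) (nhdsWithin 3 (Set.Iio 3)) (nhds 8) := by
      have : Continuous (fun s : ℝ => s ^ 2 - 1) := by fun_prop
      have h := (this.tendsto 3).mono_left (nhdsWithin_le_nhds (s := Set.Iio 3))
      norm_num at h
      exact h
    have hd : Tendsto (fun s : ℝ => s * Real.sin (s * π / 3)) (nhdsWithin 3 (Set.Iio 3))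
        (nhdsWithin 0 (Set.Ioi 0)) := by
      refine tendsto_nhdsWithin_iff.2 ⟨?_, ?_⟩
      · have : Continuous (fun s : ℝ => s * Real.sin (s * π / 3)) := by fun_prop
        have h := (this.tendsto 3).mono_left (nhdsWithin_le_nhds (s := Set.Iio 3))
        have e : (3 : ℝ) * π / 3 = π := by ring
        simpa [e] using h
      · have h0 : ∀ᶠ s : ℝ in nhdsWithin 3 (Set.Iio 3), 0 < s :=
          nhdsWithin_le_nhds (lt_mem_nhds (by norm_num))
        filter_upwards [h0, self_mem_nhdsWithin] with s hs hs3
        exact mul_pos hs (gamma2_aux_sin_pos hs hs3)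
    have := hn.pos_mul_atTop (by norm_num) hd.inv_tendsto_nhdsGT_zero
    refine this.congr fun s => ?_
    simp [gamma2, div_eq_mul_inv]
end

section
/- The curve γ(s) = (γ₁(s), γ₂(s)), with γ₁(s) = (s² − 1)(1 + cos(sπ/3))/(2s·sin(sπ/3)) and γ₂(s) = (s² − 1)/(s·sin(sπ/3)), is injective on [1, 3): if s, t ∈ [1, 3) and γ(s) = γ(t), then s = t. -/
open Real

/-- First coordinate of the curve bounding the stability domain. -/
noncomputable def gamma1 (s : ℝ) : ℝ :=
  (s ^ 2 - 1) * (1 + Real.cos (s * π / 3)) / (2 * s * Real.sin (s * π / 3))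

lemma gamma_aux_sin (s : ℝ) (hs : s ∈ Set.Ico (1 : ℝ) 3) : 0 < Real.sin (s * π / 3) := by
  have := Real.pi_pos
  obtain ⟨h1, h3⟩ := hs
  apply Real.sin_pos_of_pos_of_lt_pi
  · positivity
  · nlinarith

lemma gamma_aux_rel (s : ℝ) : gamma1 s = gamma2 s * ((1 + Real.cos (s * π / 3)) / 2) := by
  unfold gamma1 gamma2
  rw [div_mul_div_comm]
  congr 1
  ring

lemma gamma_aux_zero (s : ℝ) (hs : s ∈ Set.Ico (1 : ℝ) 3) (h : gamma2 s = 0) : s = 1 := by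
  have hp := gamma_aux_sin s hs
  obtain ⟨h1, h3⟩ := hs
  have hd : s * Real.sin (s * π / 3) ≠ 0 := by positivity
  unfold gamma2 at h
  rw [div_eq_zero_iff] at h
  have h := h.resolve_right hd
  nlinarith

/-- The curve `γ = (γ₁, γ₂)` has no self-intersections on `[1,3)`:
if `γ(s) = γ(t)` with `s, t ∈ [1,3)`, then `s = t`. -/
theorem gamma_injective_on_Ico (s t : ℝ)
    (hs : s ∈ Set.Ico (1 : ℝ) 3) (ht : t ∈ Set.Ico (1 : ℝ) 3)
    (h1 : gamma1 s = gamma1 t) (h2 : gamma2 s = gamma2 t) : s = t := by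
  by_cases h0 : gamma2 s = 0
  · rw [gamma_aux_zero s hs h0, gamma_aux_zero t ht (h2 ▸ h0)]
  · rw [gamma_aux_rel s, gamma_aux_rel t, ← h2] at h1
    have hc := mul_left_cancel₀ h0 h1
    have hc' : Real.cos (s * π / 3) = Real.cos (t * π / 3) := by linarith
    have hpi := Real.pi_pos
    have key : ∀ x ∈ Set.Ico (1 : ℝ) 3, x * π / 3 ∈ Set.Icc 0 π := by
      rintro x ⟨hx1, hx3⟩
      exact ⟨by positivity, by nlinarith⟩
    have := Real.injOn_cos (key s hs) (key t ht) hc'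
    have h4 : s * π = t * π := by linarith
    exact mul_right_cancel₀ hpi.ne' h4
end

section
/- Let s, t > 1 be real numbers, neither an integer multiple of 3, with sin(sπ/3) ≠ 0, sin(tπ/3) ≠ 0, and suppose γ(s) = γ(t) where γ(u) = ((u² − 1)(1 + cos(uπ/3))/(2u·sin(uπ/3)), (u² − 1)/(u·sin(uπ/3))) and γ₂(s) ≠ 0. Then cos(sπ/3) = cos(tπ/3), and hence there exists an integer k such that s = t + 6k or s = 6k − t. -/
open Real

/-- If `s, t > 1` are not integer multiples of 3, `sin(sπ/3) ≠ 0 ≠ sin(tπ/3)`,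
`γ(s) = γ(t)` and `γ₂(s) ≠ 0`, then `cos(sπ/3) = cos(tπ/3)`, and hence
`s = t + 6k` or `s = 6k − t` for some integer `k`. -/
theorem gamma_selfintersection_key (s t : ℝ) (hs1 : 1 < s) (ht1 : 1 < t)
    (hs3 : ∀ k : ℤ, s ≠ 3 * k) (ht3 : ∀ k : ℤ, t ≠ 3 * k)
    (hsins : Real.sin (s * π / 3) ≠ 0) (hsint : Real.sin (t * π / 3) ≠ 0)
    (h1 : gamma1 s = gamma1 t) (h2 : gamma2 s = gamma2 t)
    (hne : gamma2 s ≠ 0) :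
    Real.cos (s * π / 3) = Real.cos (t * π / 3) ∧
    ∃ k : ℤ, s = t + 6 * k ∨ s = 6 * k - t := by
  have g : ∀ u : ℝ, gamma1 u = gamma2 u * ((1 + Real.cos (u * π / 3)) / 2) := by
    intro u
    unfold gamma1 gamma2
    rw [div_mul_div_comm]
    congr 1
    ring
  have hc : Real.cos (s * π / 3) = Real.cos (t * π / 3) := by
    rw [g s, g t, ← h2] at h1
    have := mul_left_cancel₀ hne h1
    linarith
  refine ⟨hc, ?_⟩
  obtain ⟨k, hk⟩ := Real.cos_eq_cos_iff.mp hc.symm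
  refine ⟨k, ?_⟩
  rcases hk with hk | hk
  · left
    apply mul_right_cancel₀ Real.pi_ne_zero
    linarith
  · right
    apply mul_right_cancel₀ Real.pi_ne_zero
    linarith
end

section
/- Fix real numbers a and b and define F(α, λ) = λ² + (b + 2a − α)λ + 1 − b·e^{iπ/3}·λ·e^{−λπ/3}. Then F(2a, i) = 0, ∂F/∂α(2a, i) = −i, ∂F/∂λ(2a, i) = (2 + bπ/3)·i, and consequently −(∂F/∂α)(2a,i) / (∂F/∂λ)(2a,i) = 3/(6 + bπ), which is a positive real number when b > 0. -/
open Complex Real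

/-- Characteristic quasipolynomial (delay fixed at one sixth of the period 2π)
of the critical isotypical component for ⁺ℤ₃ᵗ, with coupling strength `a`,
control strength `b` and bifurcation parameter `α`. -/
noncomputable def Fqp (a b : ℝ) (α : ℝ) (z : ℂ) : ℂ :=
  z ^ 2 + ((b + 2 * a - α : ℝ) : ℂ) * z + 1 -
    (b : ℂ) * Complex.exp (Complex.I * ((π : ℝ) / 3 : ℝ)) * z *
      Complex.exp (-z * ((π : ℝ) / 3 : ℝ))

/-- `F(2a, i) = 0`, `∂F/∂α(2a,i) = −i`, `∂F/∂λ(2a,i) = (2 + bπ/3) i`, and the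
crossing speed `−(∂F/∂α)/(∂F/∂λ)` at `(2a, i)` equals `3/(6 + bπ)`, a positive
real number when `b > 0`. -/
theorem Fqp_transversality (a b : ℝ) :
    Fqp a b (2 * a) Complex.I = 0 ∧
    HasDerivAt (fun α : ℝ => Fqp a b α Complex.I) (-Complex.I) (2 * a) ∧
    HasDerivAt (fun z : ℂ => Fqp a b (2 * a) z)
      (((2 + b * π / 3 : ℝ) : ℂ) * Complex.I) Complex.I ∧
    -(-Complex.I) / (((2 + b * π / 3 : ℝ) : ℂ) * Complex.I) =
      ((3 / (6 + b * π) : ℝ) : ℂ) ∧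
    (0 < b → 0 < 3 / (6 + b * π)) := by
  have hexp : Complex.exp (Complex.I * ((π : ℝ) / 3 : ℝ)) *
      Complex.exp (-Complex.I * ((π : ℝ) / 3 : ℝ)) = 1 := by
    rw [← Complex.exp_add, neg_mul, add_neg_cancel, Complex.exp_zero]
  refine ⟨?_, ?_, ?_, ?_, ?_⟩
  · unfold Fqp
    push_cast at hexp ⊢
    linear_combination Complex.I_sq - (b : ℂ) * Complex.I * hexp
  · unfold Fqp
    have h1 : HasDerivAt (fun α : ℝ => ((b + 2 * a - α : ℝ) : ℂ)) (((-1 : ℝ)) : ℂ) (2 * a) :=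
      ((hasDerivAt_id (2 * a)).const_sub (b + 2 * a)).ofReal_comp
    have h2 := (((h1.mul_const Complex.I).const_add (Complex.I ^ 2)).add_const 1).sub_const
      ((b : ℂ) * Complex.exp (Complex.I * ((π : ℝ) / 3 : ℝ)) * Complex.I *
        Complex.exp (-Complex.I * ((π : ℝ) / 3 : ℝ)))
    refine HasDerivAt.congr_deriv h2 ?_
    push_cast
    ring
  · unfold Fqp
    have hid := hasDerivAt_id (Complex.I)
    have h3 := (hid.neg.mul_const (((π : ℝ) / 3 : ℝ) : ℂ)).cexp
    have h4 := (hid.const_mul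
      ((b : ℂ) * Complex.exp (Complex.I * ((π : ℝ) / 3 : ℝ)))).mul h3
    have h5 := (((hid.pow 2).add
      (hid.const_mul ((b + 2 * a - 2 * a : ℝ) : ℂ))).add_const 1).sub h4
    refine HasDerivAt.congr_deriv h5 ?_
    simp only [id, Pi.neg_apply]
    push_cast at hexp ⊢
    linear_combination (-(b : ℂ) + (b : ℂ) * Complex.I * (π / 3)) * hexp
  · rw [neg_neg]
    by_cases h : 6 + b * π = 0
    · have h' : 2 + b * π / 3 = 0 := by linarith
      rw [h, h']
      simp
    · have h' : 2 + b * π / 3 = (6 + b * π) / 3 := by ring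
      have hc : ((6 + b * π : ℝ) : ℂ) ≠ 0 := by exact_mod_cast h
      rw [h', Complex.ofReal_div, Complex.ofReal_div]
      have := Complex.I_ne_zero
      push_cast at hc ⊢
      field_simp
  · intro hb
    have := Real.pi_pos
    positivity
end

section
/- Define F(b, λ) = λ² + bλ + 1 + b·λ·e^{−λπ/3}. Then F(0, i) = 0, ∂F/∂λ(0, i) = 2i, ∂F/∂b(0, i) = i·(1 + e^{−iπ/3}), and the real part of −(∂F/∂b)(0,i) / (∂F/∂λ)(0,i) equals −3/4. (Hence, as the control strength b increases from 0, the root branch of F(b, ·) = 0 through λ = i moves into the open left half-plane.) -/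
open Complex Real

/-- Characteristic quasipolynomial, at the bifurcation point with `a = 0`, of
a critical isotypical component for the symmetry group ℤ₃ᵗ, with control
strength `b`. -/
noncomputable def Fctrl (b : ℝ) (z : ℂ) : ℂ :=
  z ^ 2 + (b : ℂ) * z + 1 + (b : ℂ) * z * Complex.exp (-z * ((π : ℝ) / 3 : ℝ))

/-- `F(0, i) = 0`, `∂F/∂λ(0,i) = 2i`, `∂F/∂b(0,i) = i(1 + e^{−iπ/3})`, and
`Re(−(∂F/∂b)/(∂F/∂λ)) = −3/4` at that point: turning on the control moves the
root through `λ = i` into the left half-plane. -/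
theorem Fctrl_control_stabilizes :
    Fctrl 0 Complex.I = 0 ∧
    HasDerivAt (fun z : ℂ => Fctrl 0 z) (2 * Complex.I) Complex.I ∧
    HasDerivAt (fun b : ℝ => Fctrl b Complex.I)
      (Complex.I * (1 + Complex.exp (-Complex.I * ((π : ℝ) / 3 : ℝ)))) 0 ∧
    (-(Complex.I * (1 + Complex.exp (-Complex.I * ((π : ℝ) / 3 : ℝ)))) /
        (2 * Complex.I)).re = -(3 / 4) := by
  refine ⟨?_, ?_, ?_, ?_⟩
  · simp [Fctrl]
  · have h : (fun z : ℂ => Fctrl 0 z) = fun z => z ^ 2 + 1 := by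
      funext z
      simp [Fctrl]
    rw [h]
    simpa using ((hasDerivAt_id Complex.I).pow 2).add_const (1 : ℂ)
  · have h : (fun b : ℝ => Fctrl b Complex.I) = fun b : ℝ =>
        (b : ℂ) * (Complex.I * (1 + Complex.exp (-Complex.I * ((π : ℝ) / 3 : ℝ)))) := by
      funext b
      simp only [Fctrl, Complex.I_sq]
      ring
    rw [h]
    have h2 : HasDerivAt (fun b : ℝ => (b : ℂ)) 1 0 := Complex.ofRealCLM.hasDerivAt
    simpa only [one_mul] using
      h2.mul_const (Complex.I * (1 + Complex.exp (-Complex.I * ((π : ℝ) / 3 : ℝ))))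
  · have h : -(Complex.I * (1 + Complex.exp (-Complex.I * ((π : ℝ) / 3 : ℝ)))) /
        (2 * Complex.I) =
        ((-(1 / 2) : ℝ) : ℂ) * (1 + Complex.exp (((-(π / 3) : ℝ) : ℂ) * Complex.I)) := by
      have e : -Complex.I * ((π / 3 : ℝ) : ℂ) = ((-(π / 3) : ℝ) : ℂ) * Complex.I := by
        push_cast
        ring
      rw [e, div_eq_iff (mul_ne_zero two_ne_zero Complex.I_ne_zero)]
      push_cast
      ring
    rw [h, Complex.re_ofReal_mul, Complex.add_re, Complex.exp_ofReal_mul_I_re, Real.cos_neg,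
      Real.cos_pi_div_three, Complex.one_re]
    norm_num
end

section
/- Let ℬ be the 8×8 coupling matrix, let k be a real number, and let v ∈ ℝ⁸ be a vector all of whose components equal +1 or −1 and which satisfies ℬv = −2k·v. If u : ℝ → ℝ solves the scalar Van der Pol equation ü = (α − k·a − u²)·u̇ − u, then x(t) = u(t)·v solves the coupled system ẍ = (α − x²)·ẋ − x + (a/2)·ℬẋ on ℝ⁸, where products of vectors are taken componentwise ((x²·ẋ)_j = x_j² ẋ_j). -/
/-- The 8×8 coupling matrix of the cube of Van der Pol oscillators. -/
def cubeCoupling : Matrix (Fin 8) (Fin 8) ℝ :=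
  !![-3, 1, 0, 1, 1, 0, 0, 0;
      1,-3, 1, 0, 0, 1, 0, 0;
      0, 1,-3, 1, 0, 0, 1, 0;
      1, 0, 1,-3, 0, 0, 0, 1;
      1, 0, 0, 0,-3, 1, 0, 1;
      0, 1, 0, 0, 1,-3, 1, 0;
      0, 0, 1, 0, 0, 1,-3, 1;
      0, 0, 0, 1, 1, 0, 1,-3]

/-- If `v ∈ {±1}⁸` is an eigenvector of ℬ with eigenvalue `−2k` and `u` solves
the scalar Van der Pol equation `ü = (α − ka − u²)u̇ − u`, then `x(t) = u(t)v`
solves the coupled system `ẍ = (α − x²)ẋ − x + (a/2)ℬẋ` (componentwise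
products). -/
theorem scalar_reduction (α a k : ℝ) (v : Fin 8 → ℝ)
    (hv : ∀ j, v j = 1 ∨ v j = -1)
    (hBv : cubeCoupling.mulVec v = (-2 * k) • v)
    (u u' u'' : ℝ → ℝ)
    (hu : ∀ t, HasDerivAt u (u' t) t)
    (hu' : ∀ t, HasDerivAt u' (u'' t) t)
    (hode : ∀ t, u'' t = (α - k * a - (u t) ^ 2) * u' t - u t) :
    ∀ t (j : Fin 8),
      HasDerivAt (fun r => u r * v j) (u' t * v j) t ∧
      HasDerivAt (fun r => u' r * v j) (u'' t * v j) t ∧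
      u'' t * v j =
        (α - (u t * v j) ^ 2) * (u' t * v j) - u t * v j +
          (a / 2) * cubeCoupling.mulVec (fun i => u' t * v i) j := by
  intro t j
  have h1 : (fun i => u' t * v i) = u' t • v := by
    funext i
    simp
  have h2 : (v j) ^ 2 = 1 := by
    rcases hv j with h | h <;> rw [h] <;> norm_num
  refine ⟨(hu t).mul_const _, (hu' t).mul_const _, ?_⟩
  rw [h1, Matrix.mulVec_smul, hBv, hode]
  simp only [Pi.smul_apply, smul_eq_mul]
  rw [mul_pow, h2]
  ring
end

section
/- Suppose (u₁, u₂) : ℝ → ℝ² solves the system ü₁ − α u̇₁ + u̇₁u₁² + u₁ = (3a/2)(u̇₂ − u̇₁), ü₂ − α u̇₂ + u̇₂u₂² + u₂ = (a/2)(u̇₁ − 5u̇₂). Then x(t) = (u₁, u₂, −u₂, u₂, u₂, −u₂, −u₁, −u₂)(t) solves the coupled Van der Pol system ẍ = (α − x²)·ẋ − x + (a/2)·ℬẋ on ℝ⁸, where products of vectors are taken componentwise ((x²·ẋ)_j = x_j² ẋ_j). -/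
/-- If `(u₁,u₂)` solves the reduced system
`ü₁ − αu̇₁ + u̇₁u₁² + u₁ = (3a/2)(u̇₂ − u̇₁)`,
`ü₂ − αu̇₂ + u̇₂u₂² + u₂ = (a/2)(u̇₁ − 5u̇₂)`,
then `x = (u₁, u₂, −u₂, u₂, u₂, −u₂, −u₁, −u₂)` solves the coupled Van der Pol
system `ẍ = (α − x²)ẋ − x + (a/2)ℬẋ` (componentwise products). -/
theorem reduction_D3minus (α a : ℝ)
    (u₁ u₁' u₁'' u₂ u₂' u₂'' : ℝ → ℝ)
    (hu₁ : ∀ t, HasDerivAt u₁ (u₁' t) t)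
    (hu₁' : ∀ t, HasDerivAt u₁' (u₁'' t) t)
    (hu₂ : ∀ t, HasDerivAt u₂ (u₂' t) t)
    (hu₂' : ∀ t, HasDerivAt u₂' (u₂'' t) t)
    (hode₁ : ∀ t, u₁'' t - α * u₁' t + u₁' t * (u₁ t) ^ 2 + u₁ t =
      (3 * a / 2) * (u₂' t - u₁' t))
    (hode₂ : ∀ t, u₂'' t - α * u₂' t + u₂' t * (u₂ t) ^ 2 + u₂ t =
      (a / 2) * (u₁' t - 5 * u₂' t)) :
    ∀ t (j : Fin 8),
      HasDerivAt (fun r => ![u₁ r, u₂ r, -u₂ r, u₂ r, u₂ r, -u₂ r, -u₁ r, -u₂ r] j)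
        (![u₁' t, u₂' t, -u₂' t, u₂' t, u₂' t, -u₂' t, -u₁' t, -u₂' t] j) t ∧
      HasDerivAt (fun r => ![u₁' r, u₂' r, -u₂' r, u₂' r, u₂' r, -u₂' r, -u₁' r, -u₂' r] j)
        (![u₁'' t, u₂'' t, -u₂'' t, u₂'' t, u₂'' t, -u₂'' t, -u₁'' t, -u₂'' t] j) t ∧
      ![u₁'' t, u₂'' t, -u₂'' t, u₂'' t, u₂'' t, -u₂'' t, -u₁'' t, -u₂'' t] j =
        (α - (![u₁ t, u₂ t, -u₂ t, u₂ t, u₂ t, -u₂ t, -u₁ t, -u₂ t] j) ^ 2) *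
            ![u₁' t, u₂' t, -u₂' t, u₂' t, u₂' t, -u₂' t, -u₁' t, -u₂' t] j -
          ![u₁ t, u₂ t, -u₂ t, u₂ t, u₂ t, -u₂ t, -u₁ t, -u₂ t] j +
          (a / 2) * cubeCoupling.mulVec
            ![u₁' t, u₂' t, -u₂' t, u₂' t, u₂' t, -u₂' t, -u₁' t, -u₂' t] j := by
  intro t j
  have h1 := hode₁ t
  have h2 := hode₂ t
  refine ⟨?_, ?_, ?_⟩
  · fin_cases j
    · exact hu₁ t
    · exact hu₂ t
    · exact (hu₂ t).neg
    · exact hu₂ t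
    · exact hu₂ t
    · exact (hu₂ t).neg
    · exact (hu₁ t).neg
    · exact (hu₂ t).neg
  · fin_cases j
    · exact hu₁' t
    · exact hu₂' t
    · exact (hu₂' t).neg
    · exact hu₂' t
    · exact hu₂' t
    · exact (hu₂' t).neg
    · exact (hu₁' t).neg
    · exact (hu₂' t).neg
  · fin_cases j <;>
      simp [cubeCoupling, Matrix.mulVec, dotProduct, Fin.sum_univ_succ] <;>
      linarith
end

section
/- Suppose (u₁, u₂) : ℝ → ℝ² solves the system ü₁ − α u̇₁ + u̇₁u₁² + u₁ = (3a/2)(u̇₂ − u̇₁), ü₂ − α u̇₂ + u̇₂u₂² + u₂ = (a/2)(u̇₁ − u̇₂). Then x(t) = (u₁, u₂, u₂, u₂, u₂, u₂, u₁, u₂)(t) solves the coupled Van der Pol system ẍ = (α − x²)·ẋ − x + (a/2)·ℬẋ on ℝ⁸, where products of vectors are taken componentwise ((x²·ẋ)_j = x_j² ẋ_j). -/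
/-- If `(u₁,u₂)` solves the reduced system
`ü₁ − αu̇₁ + u̇₁u₁² + u₁ = (3a/2)(u̇₂ − u̇₁)`,
`ü₂ − αu̇₂ + u̇₂u₂² + u₂ = (a/2)(u̇₁ − u̇₂)`,
then `x = (u₁, u₂, u₂, u₂, u₂, u₂, u₁, u₂)` solves the coupled Van der Pol
system `ẍ = (α − x²)ẋ − x + (a/2)ℬẋ` (componentwise products). -/
theorem reduction_D3z_plus (α a : ℝ)
    (u₁ u₁' u₁'' u₂ u₂' u₂'' : ℝ → ℝ)
    (hu₁ : ∀ t, HasDerivAt u₁ (u₁' t) t)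
    (hu₁' : ∀ t, HasDerivAt u₁' (u₁'' t) t)
    (hu₂ : ∀ t, HasDerivAt u₂ (u₂' t) t)
    (hu₂' : ∀ t, HasDerivAt u₂' (u₂'' t) t)
    (hode₁ : ∀ t, u₁'' t - α * u₁' t + u₁' t * (u₁ t) ^ 2 + u₁ t =
      (3 * a / 2) * (u₂' t - u₁' t))
    (hode₂ : ∀ t, u₂'' t - α * u₂' t + u₂' t * (u₂ t) ^ 2 + u₂ t =
      (a / 2) * (u₁' t - u₂' t)) :
    ∀ t (j : Fin 8),
      HasDerivAt (fun r => ![u₁ r, u₂ r, u₂ r, u₂ r, u₂ r, u₂ r, u₁ r, u₂ r] j)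
        (![u₁' t, u₂' t, u₂' t, u₂' t, u₂' t, u₂' t, u₁' t, u₂' t] j) t ∧
      HasDerivAt (fun r => ![u₁' r, u₂' r, u₂' r, u₂' r, u₂' r, u₂' r, u₁' r, u₂' r] j)
        (![u₁'' t, u₂'' t, u₂'' t, u₂'' t, u₂'' t, u₂'' t, u₁'' t, u₂'' t] j) t ∧
      ![u₁'' t, u₂'' t, u₂'' t, u₂'' t, u₂'' t, u₂'' t, u₁'' t, u₂'' t] j =
        (α - (![u₁ t, u₂ t, u₂ t, u₂ t, u₂ t, u₂ t, u₁ t, u₂ t] j) ^ 2) *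
            ![u₁' t, u₂' t, u₂' t, u₂' t, u₂' t, u₂' t, u₁' t, u₂' t] j -
          ![u₁ t, u₂ t, u₂ t, u₂ t, u₂ t, u₂ t, u₁ t, u₂ t] j +
          (a / 2) * cubeCoupling.mulVec
            ![u₁' t, u₂' t, u₂' t, u₂' t, u₂' t, u₂' t, u₁' t, u₂' t] j := by
  intro t j
  have h1 := hode₁ t
  have h2 := hode₂ t
  refine ⟨?_, ?_, ?_⟩
  · fin_cases j
    all_goals first | exact hu₁ t | exact hu₂ t
  · fin_cases j
    all_goals first | exact hu₁' t | exact hu₂' t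
  · fin_cases j <;>
      simp [cubeCoupling, Matrix.mulVec, dotProduct, Fin.sum_univ_succ] <;>
      first | linear_combination h1 | linear_combination h2
end

section
/- Let T₁, T₂, T₃ be the 8×8 permutation matrices of the permutations (1 2 3 4)(5 6 7 8), (1 7)(2 6)(3 5)(4 8), and (1 7)(2 8)(3 5)(4 6) of {1,…,8}. Then each T_m commutes with ℬ (T_mℬ = ℬT_m), and consequently the right-hand side f(α, a, x, y) = (α − x²)·y − x + (a/2)ℬy of the coupled Van der Pol system (componentwise products) satisfies T_m f(α, a, x, y) = f(α, a, T_m x, T_m y) for all x, y ∈ ℝ⁸ and all real α, a; moreover f(α, a, −x, −y) = −f(α, a, x, y). -/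
/-- The permutation matrix of a map `σ` of indices: `(T x)_i = x_{σ(i)}`. -/
def permMat (σ : Fin 8 → Fin 8) : Matrix (Fin 8) (Fin 8) ℝ :=
  Matrix.of fun i j => if σ i = j then 1 else 0

/-- The permutation (1 2 3 4)(5 6 7 8) (on indices 0,…,7). -/
def sigma1 : Fin 8 → Fin 8 := ![1, 2, 3, 0, 5, 6, 7, 4]

/-- The permutation (1 7)(2 6)(3 5)(4 8) (on indices 0,…,7). -/
def sigma2 : Fin 8 → Fin 8 := ![6, 5, 4, 7, 2, 1, 0, 3]

/-- The permutation (1 7)(2 8)(3 5)(4 6) (on indices 0,…,7). -/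
def sigma3 : Fin 8 → Fin 8 := ![6, 7, 4, 5, 2, 3, 0, 1]

/-- Right-hand side of the coupled Van der Pol system
`ẍ = (α − x²)ẋ − x + (a/2)ℬẋ` (componentwise products). -/
noncomputable def vdpRHS (α a : ℝ) (x y : Fin 8 → ℝ) : Fin 8 → ℝ :=
  fun j => (α - (x j) ^ 2) * y j - x j + (a / 2) * cubeCoupling.mulVec y j

theorem permMat_mulVec (σ : Fin 8 → Fin 8) (v : Fin 8 → ℝ) (i : Fin 8) :
    (permMat σ).mulVec v i = v (σ i) := by
  simp [permMat, Matrix.mulVec, dotProduct]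

/-- Commutation follows from invariance of the entries under an invertible `σ`. -/
theorem permMat_comm (σ τ : Fin 8 → Fin 8) (h1 : ∀ k, τ (σ k) = k) (h2 : ∀ k, σ (τ k) = k)
    (h : ∀ i k, cubeCoupling (σ i) (σ k) = cubeCoupling i k) :
    permMat σ * cubeCoupling = cubeCoupling * permMat σ := by
  ext i j
  have e : ∀ k, (σ k = j) ↔ (k = τ j) := fun k =>
    ⟨fun hk => by rw [← hk, h1], fun hk => by rw [hk, h2]⟩
  have := h i (τ j)
  rw [h2] at this
  simp [Matrix.mul_apply, permMat, e, this]

theorem vdp_equivariant_of_comm (σ : Fin 8 → Fin 8)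
    (h : permMat σ * cubeCoupling = cubeCoupling * permMat σ) (α a : ℝ) (x y : Fin 8 → ℝ) :
    (permMat σ).mulVec (vdpRHS α a x y) =
      vdpRHS α a ((permMat σ).mulVec x) ((permMat σ).mulVec y) := by
  ext i
  have hy : cubeCoupling.mulVec ((permMat σ).mulVec y) i = cubeCoupling.mulVec y (σ i) := by
    rw [Matrix.mulVec_mulVec, ← h, ← Matrix.mulVec_mulVec, permMat_mulVec]
  simp only [permMat_mulVec, vdpRHS, hy]

theorem comm1 : permMat sigma1 * cubeCoupling = cubeCoupling * permMat sigma1 := by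
  refine permMat_comm sigma1 ![3, 0, 1, 2, 7, 4, 5, 6] (by decide) (by decide) ?_
  intro i k
  fin_cases i <;> fin_cases k <;> rfl

theorem comm2 : permMat sigma2 * cubeCoupling = cubeCoupling * permMat sigma2 := by
  refine permMat_comm sigma2 sigma2 (by decide) (by decide) ?_
  intro i k
  fin_cases i <;> fin_cases k <;> rfl

theorem comm3 : permMat sigma3 * cubeCoupling = cubeCoupling * permMat sigma3 := by
  refine permMat_comm sigma3 sigma3 (by decide) (by decide) ?_
  intro i k
  fin_cases i <;> fin_cases k <;> rfl

/-- The permutation matrices of (1 2 3 4)(5 6 7 8), (1 7)(2 6)(3 5)(4 8) and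
(1 7)(2 8)(3 5)(4 6) commute with ℬ; consequently the right-hand side `f` of
the coupled Van der Pol system is equivariant under them, and moreover `f` is
odd: `f(α,a,−x,−y) = −f(α,a,x,y)`. -/
theorem vdp_equivariance :
    (permMat sigma1 * cubeCoupling = cubeCoupling * permMat sigma1) ∧
    (permMat sigma2 * cubeCoupling = cubeCoupling * permMat sigma2) ∧
    (permMat sigma3 * cubeCoupling = cubeCoupling * permMat sigma3) ∧
    (∀ (α a : ℝ) (x y : Fin 8 → ℝ),
      (permMat sigma1).mulVec (vdpRHS α a x y) =
        vdpRHS α a ((permMat sigma1).mulVec x) ((permMat sigma1).mulVec y)) ∧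
    (∀ (α a : ℝ) (x y : Fin 8 → ℝ),
      (permMat sigma2).mulVec (vdpRHS α a x y) =
        vdpRHS α a ((permMat sigma2).mulVec x) ((permMat sigma2).mulVec y)) ∧
    (∀ (α a : ℝ) (x y : Fin 8 → ℝ),
      (permMat sigma3).mulVec (vdpRHS α a x y) =
        vdpRHS α a ((permMat sigma3).mulVec x) ((permMat sigma3).mulVec y)) ∧
    (∀ (α a : ℝ) (x y : Fin 8 → ℝ),
      vdpRHS α a (-x) (-y) = -vdpRHS α a x y) := by
  refine ⟨comm1, comm2, comm3, vdp_equivariant_of_comm _ comm1,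
    vdp_equivariant_of_comm _ comm2, vdp_equivariant_of_comm _ comm3, ?_⟩
  intro α a x y
  ext j
  simp only [vdpRHS, Matrix.mulVec_neg, Pi.neg_apply]
  ring
end
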